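/- arXiv:math/0507436 — 8 statements merged into one kernel-verified Lean document; each statement's English description precedes it below -/
import Mathlib

section
/- Gauss summation formula: let a, b, c ∈ ℂ with c not a nonpositive integer and Re(c−a−b) > 0. Then the series Σ_{n=0}^∞ ((a)_n (b)_n)/((c)_n n!) converges and F(a,b,c|1) := Σ_{n=0}^∞ ((a)_n (b)_n)/((c)_n n!) = Γ(c)Γ(c−a−b) / (Γ(c−a)Γ(c−b)), where Γ denotes the complex Gamma function. -/
open Complex

/-- The `n`-th term of the Gauss hypergeometric series with parameters `a b c` at `z = 1`. -/
noncomputable def hypTermOne (a b c : ℂ) (n : ℕ) : ℂ :=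
  (ascPochhammer ℂ n).eval a * (ascPochhammer ℂ n).eval b /
    ((ascPochhammer ℂ n).eval c * (n.factorial : ℂ))

open Filter Topology in
/-- Gauss's product formula for `1 / Γ`, valid at the poles of `Γ` as well. -/
lemma inv_GammaSeq_tendsto (s : ℂ) :
    Tendsto (fun n => (Complex.GammaSeq s n)⁻¹) atTop (𝓝 (Complex.Gamma s)⁻¹) := by
  by_cases hs : ∀ m : ℕ, s ≠ -m
  · exact (Complex.GammaSeq_tendsto_Gamma s).inv₀ (Complex.Gamma_ne_zero hs)
  · push Not at hs
    obtain ⟨k, rfl⟩ := hs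
    rw [Complex.Gamma_neg_nat_eq_zero]
    refine tendsto_const_nhds.congr' ?_
    filter_upwards [eventually_ge_atTop k] with n hn
    have : ∏ j ∈ Finset.range (n + 1), (-(k : ℂ) + j) = 0 :=
      Finset.prod_eq_zero (Finset.mem_range.mpr (Nat.lt_succ_of_le hn)) (by simp)
    simp [Complex.GammaSeq, this]

lemma ascPochhammer_eval_eq_prod_range_add (s : ℂ) (n : ℕ) :
    (ascPochhammer ℂ n).eval s = ∏ j ∈ Finset.range n, (s + j) := by
  induction n with
  | zero => simp
  | succ n ih => rw [ascPochhammer_succ_eval, ih, Finset.prod_range_succ]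

lemma ascPochhammer_succ_eval_eq_inv_GammaSeq (s : ℂ) {n : ℕ} (hn : n ≠ 0) :
    (ascPochhammer ℂ (n + 1)).eval s =
      (n : ℂ) ^ s * n.factorial * (Complex.GammaSeq s n)⁻¹ := by
  have h1 : (n : ℂ) ^ s ≠ 0 := by simp [Complex.cpow_eq_zero_iff, hn]
  have h2 : (n.factorial : ℂ) ≠ 0 := by exact_mod_cast n.factorial_ne_zero
  rw [ascPochhammer_eval_eq_prod_range_add, Complex.GammaSeq, inv_div]
  field_simp

lemma ascPochhammer_eval_ne_zero {c : ℂ} (hc : ∀ n : ℕ, c ≠ -(n : ℂ)) (n : ℕ) :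
    (ascPochhammer ℂ n).eval c ≠ 0 := by
  rw [ascPochhammer_eval_eq_prod_range_add]
  exact Finset.prod_ne_zero_iff.mpr fun j _ h => hc j (eq_neg_of_add_eq_zero_left h)

lemma ascPochhammer_succ_eval_left (c : ℂ) (n : ℕ) :
    (ascPochhammer ℂ (n + 1)).eval c = c * (ascPochhammer ℂ n).eval (c + 1) := by
  rw [ascPochhammer_eval_eq_prod_range_add, ascPochhammer_eval_eq_prod_range_add,
    Finset.prod_range_succ', mul_comm]
  simp [add_assoc, add_comm (1 : ℂ)]

/-- The exact power-law form of the terms of the series. -/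
lemma succ_mul_hypTermOne_succ (a b c : ℂ) {n : ℕ} (hn : n ≠ 0) :
    ((n + 1 : ℕ) : ℂ) * hypTermOne a b c (n + 1) = (n : ℂ) ^ (-(c - a - b)) *
      ((Complex.GammaSeq a n)⁻¹ * (Complex.GammaSeq b n)⁻¹ * Complex.GammaSeq c n) := by
  have hn' : (n : ℂ) ≠ 0 := by exact_mod_cast hn
  have h2 : (n.factorial : ℂ) ≠ 0 := by exact_mod_cast n.factorial_ne_zero
  have h3 : ((n : ℂ) + 1) ≠ 0 := by exact_mod_cast n.succ_ne_zero
  have h4 : (n : ℂ) ^ (-(c - a - b)) = (n : ℂ) ^ a * (n : ℂ) ^ b * ((n : ℂ) ^ c)⁻¹ := by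
    rw [← Complex.cpow_neg, ← Complex.cpow_add _ _ hn', ← Complex.cpow_add _ _ hn']
    ring_nf
  have h1 : (n : ℂ) ^ c ≠ 0 := by simp [Complex.cpow_eq_zero_iff, hn]
  rw [hypTermOne, ascPochhammer_succ_eval_eq_inv_GammaSeq a hn,
    ascPochhammer_succ_eval_eq_inv_GammaSeq b hn, ascPochhammer_succ_eval_eq_inv_GammaSeq c hn, h4,
    Nat.factorial_succ, div_eq_mul_inv]
  push_cast
  simp only [mul_inv, inv_inv]
  field_simp

open Filter Topology in
lemma tendsto_GammaSeq_quotient (a b c : ℂ) :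
    Tendsto (fun n => (Complex.GammaSeq a n)⁻¹ * (Complex.GammaSeq b n)⁻¹ * Complex.GammaSeq c n)
      atTop (𝓝 ((Complex.Gamma a)⁻¹ * (Complex.Gamma b)⁻¹ * Complex.Gamma c)) :=
  ((inv_GammaSeq_tendsto a).mul (inv_GammaSeq_tendsto b)).mul (Complex.GammaSeq_tendsto_Gamma c)

lemma norm_natCast_cpow_neg {n : ℕ} (hn : n ≠ 0) (s : ℂ) :
    ‖(n : ℂ) ^ (-s)‖ = (n : ℝ) ^ (-s.re) := by
  rw [Complex.norm_natCast_cpow_of_pos (Nat.pos_of_ne_zero hn), Complex.neg_re]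

open Filter Topology in
lemma tendsto_natCast_mul_hypTermOne {a b c : ℂ} (hre : 0 < (c - a - b).re) :
    Tendsto (fun n : ℕ => (n : ℂ) * hypTermOne a b c n) atTop (𝓝 0) := by
  rw [← tendsto_add_atTop_iff_nat 1]
  have h : Tendsto (fun n : ℕ => (n : ℂ) ^ (-(c - a - b))) atTop (𝓝 0) := by
    rw [tendsto_zero_iff_norm_tendsto_zero]
    refine ((tendsto_rpow_neg_atTop hre).comp tendsto_natCast_atTop_atTop).congr' ?_
    filter_upwards [eventually_ne_atTop 0] with n hn
    exact (norm_natCast_cpow_neg hn _).symm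
  have h' := h.mul (tendsto_GammaSeq_quotient a b c)
  rw [zero_mul] at h'
  refine h'.congr' ?_
  filter_upwards [eventually_ne_atTop 0] with n hn
  exact (succ_mul_hypTermOne_succ a b c hn).symm

open Filter Topology in
lemma summable_hypTermOne {a b c : ℂ} (hre : 0 < (c - a - b).re) :
    Summable (hypTermOne a b c) := by
  rw [← summable_nat_add_iff 1]
  obtain ⟨C, hC⟩ := (tendsto_GammaSeq_quotient a b c).norm.bddAbove_range
  have hs : Summable fun n : ℕ => (n : ℝ) ^ (-(c - a - b).re - 1) :=
    Real.summable_nat_rpow.mpr (by linarith)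
  refine summable_of_isBigO_nat hs (Asymptotics.IsBigO.of_bound C ?_)
  filter_upwards [eventually_ne_atTop 0] with n hn
  have hn0 : (0 : ℝ) < n := by exact_mod_cast Nat.pos_of_ne_zero hn
  have key := congrArg norm (succ_mul_hypTermOne_succ a b c hn)
  rw [norm_mul, norm_mul, norm_natCast_cpow_neg hn, Complex.norm_natCast] at key
  have hCn := hC (Set.mem_range_self n)
  rw [Real.norm_of_nonneg (by positivity), Real.rpow_sub_one hn0.ne', ← mul_div_assoc,
    le_div_iff₀ hn0]
  calc ‖hypTermOne a b c (n + 1)‖ * n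
      ≤ ((n + 1 : ℕ) : ℝ) * ‖hypTermOne a b c (n + 1)‖ := by
        push_cast; nlinarith [norm_nonneg (hypTermOne a b c (n + 1))]
    _ ≤ C * (n : ℝ) ^ (-(c - a - b).re) := by
        rw [key, mul_comm C]
        exact mul_le_mul_of_nonneg_left hCn (by positivity)

/-- The telescoping identity behind Gauss's contiguous relation. -/
lemma hypTermOne_contiguous (a b : ℂ) {c : ℂ} (hc : ∀ n : ℕ, c ≠ -(n : ℂ)) (n : ℕ) :
    c * (c - a - b) * hypTermOne a b c n - (c - a) * (c - b) * hypTermOne a b (c + 1) n =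
      c * (n * hypTermOne a b c n) - c * ((n + 1 : ℕ) * hypTermOne a b c (n + 1)) := by
  have hcn : c + n ≠ 0 := fun h => hc n (eq_neg_of_add_eq_zero_left h)
  have hc0 : c ≠ 0 := by simpa using hc 0
  have hP := ascPochhammer_eval_ne_zero hc n
  have h2 : (n.factorial : ℂ) ≠ 0 := by exact_mod_cast n.factorial_ne_zero
  have h3 : ((n : ℂ) + 1) ≠ 0 := by exact_mod_cast n.succ_ne_zero
  have hshift : (ascPochhammer ℂ n).eval (c + 1) = (ascPochhammer ℂ n).eval c * (c + n) / c := by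
    rw [eq_div_iff hc0, mul_comm, ← ascPochhammer_succ_eval_left, ascPochhammer_succ_eval]
  simp only [hypTermOne, hshift, ascPochhammer_succ_eval, Nat.factorial_succ]
  push_cast
  field_simp
  ring

lemma add_one_ne_neg_natCast {c : ℂ} (hc : ∀ n : ℕ, c ≠ -(n : ℂ)) (n : ℕ) :
    c + 1 ≠ -(n : ℂ) := fun h => hc (n + 1) (by push_cast; linear_combination h)

open Filter Topology in
/-- Gauss's contiguous relation at `z = 1`. -/
lemma tsum_hypTermOne_contiguous {a b c : ℂ} (hc : ∀ n : ℕ, c ≠ -(n : ℂ))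
    (hre : 0 < (c - a - b).re) :
    c * (c - a - b) * ∑' n, hypTermOne a b c n =
      (c - a) * (c - b) * ∑' n, hypTermOne a b (c + 1) n := by
  have hre' : 0 < (c + 1 - a - b).re := by
    simp only [Complex.sub_re, Complex.add_re, Complex.one_re] at hre ⊢; linarith
  have h1 := ((summable_hypTermOne hre).hasSum.mul_left (c * (c - a - b))).sub
    ((summable_hypTermOne hre').hasSum.mul_left ((c - a) * (c - b)))
  have h2 := h1.tendsto_sum_nat
  have h3 : Tendsto (fun N => ∑ n ∈ Finset.range N, (c * (c - a - b) * hypTermOne a b c n -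
      (c - a) * (c - b) * hypTermOne a b (c + 1) n)) atTop (𝓝 0) := by
    have h4 := (tendsto_natCast_mul_hypTermOne hre).const_mul (-c)
    rw [mul_zero] at h4
    refine h4.congr fun N => ?_
    simp_rw [hypTermOne_contiguous a b hc]
    rw [Finset.sum_range_sub' (fun n : ℕ => c * ((n : ℂ) * hypTermOne a b c n))]
    simp
  exact sub_eq_zero.mp (tendsto_nhds_unique h2 h3)

lemma tsum_hypTermOne_contiguous_iterate {a b : ℂ} (m : ℕ) {c : ℂ} (hc : ∀ n : ℕ, c ≠ -(n : ℂ))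
    (hre : 0 < (c - a - b).re) :
    (ascPochhammer ℂ m).eval c * (ascPochhammer ℂ m).eval (c - a - b) *
        ∑' n, hypTermOne a b c n =
      (ascPochhammer ℂ m).eval (c - a) * (ascPochhammer ℂ m).eval (c - b) *
        ∑' n, hypTermOne a b (c + m) n := by
  induction m generalizing c with
  | zero => simp
  | succ m ih =>
    have hre' : 0 < (c + 1 - a - b).re := by
      simp only [Complex.sub_re, Complex.add_re, Complex.one_re] at hre ⊢; linarith
    have h := ih (add_one_ne_neg_natCast hc) hre'
    have h0 := tsum_hypTermOne_contiguous hc hre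
    simp only [ascPochhammer_succ_eval_left]
    rw [show c - a - b + 1 = c + 1 - a - b by ring, show c - a + 1 = c + 1 - a by ring,
      show c - b + 1 = c + 1 - b by ring,
      show c + ((m + 1 : ℕ) : ℂ) = c + 1 + m by push_cast; ring]
    linear_combination (ascPochhammer ℂ m).eval (c + 1) *
      (ascPochhammer ℂ m).eval (c + 1 - a - b) * h0 + (c - a) * (c - b) * h

lemma norm_ascPochhammer_eval_le (a : ℂ) (n : ℕ) :
    ‖(ascPochhammer ℂ n).eval a‖ ≤ ‖(ascPochhammer ℂ n).eval (‖a‖ : ℂ)‖ := by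
  simp only [ascPochhammer_eval_eq_prod_range_add, norm_prod]
  refine Finset.prod_le_prod (fun _ _ => norm_nonneg _) fun j _ => ?_
  rw [show (‖a‖ : ℂ) + j = ((‖a‖ + j : ℝ) : ℂ) by push_cast; ring, Complex.norm_real,
    Real.norm_of_nonneg (by positivity)]
  exact (norm_add_le _ _).trans (by simp)

lemma norm_ascPochhammer_eval_ofReal_le {x : ℝ} (hx : 0 ≤ x) {c : ℂ} (hc : x ≤ c.re) (n : ℕ) :
    ‖(ascPochhammer ℂ n).eval (x : ℂ)‖ ≤ ‖(ascPochhammer ℂ n).eval c‖ := by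
  simp only [ascPochhammer_eval_eq_prod_range_add, norm_prod]
  refine Finset.prod_le_prod (fun _ _ => norm_nonneg _) fun j _ => ?_
  rw [show (x : ℂ) + j = ((x + j : ℝ) : ℂ) by push_cast; ring, Complex.norm_real,
    Real.norm_of_nonneg (by positivity)]
  refine le_trans ?_ (Complex.re_le_norm _)
  simpa using hc

lemma norm_hypTermOne_le (a b : ℂ) {x : ℝ} (hx : 0 < x) {c : ℂ} (hc : x ≤ c.re) (n : ℕ) :
    ‖hypTermOne a b c n‖ ≤ ‖hypTermOne (‖a‖ : ℂ) (‖b‖ : ℂ) (x : ℂ) n‖ := by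
  have hx0 : ∀ k : ℕ, (x : ℂ) ≠ -(k : ℂ) := fun k h => by
    have := congrArg Complex.re h
    simp only [Complex.ofReal_re, Complex.neg_re, Complex.natCast_re] at this
    linarith [(Nat.cast_nonneg k : (0 : ℝ) ≤ k)]
  have hpos := norm_pos_iff.mpr (ascPochhammer_eval_ne_zero hx0 n)
  have hfac : (0 : ℝ) < n.factorial := by exact_mod_cast n.factorial_pos
  simp only [hypTermOne, norm_div, norm_mul, Complex.norm_natCast]
  gcongr
  · exact norm_ascPochhammer_eval_le a n
  · exact norm_ascPochhammer_eval_le b n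
  · exact norm_ascPochhammer_eval_ofReal_le hx.le hc n

open Filter Topology in
lemma tendsto_hypTermOne_add_natCast (a b c : ℂ) (n : ℕ) :
    Tendsto (fun m : ℕ => hypTermOne a b (c + m) n) atTop (𝓝 (if n = 0 then 1 else 0)) := by
  rcases Nat.eq_zero_or_pos n with rfl | hn
  · simp [hypTermOne]
  · rw [if_neg hn.ne']
    have hdeg : 0 < (ascPochhammer ℂ n).degree := by
      rw [← Polynomial.natDegree_pos_iff_degree_pos, ascPochhammer_natDegree]
      exact hn
    have hz : Tendsto (fun m : ℕ => ‖c + m‖) atTop atTop := by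
      refine tendsto_atTop_mono (fun m => Complex.re_le_norm _) ?_
      simp only [Complex.add_re, Complex.natCast_re]
      exact tendsto_atTop_add_const_left _ _ tendsto_natCast_atTop_atTop
    have h := tendsto_norm_atTop_iff_cobounded.mp
      ((ascPochhammer ℂ n).tendsto_norm_atTop hdeg hz)
    have h' := (tendsto_inv₀_cobounded.comp h).const_mul
      ((ascPochhammer ℂ n).eval a * (ascPochhammer ℂ n).eval b / n.factorial)
    rw [mul_zero] at h'
    refine h'.congr fun m => ?_
    simp only [hypTermOne, Function.comp_apply, div_eq_mul_inv, mul_inv]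
    ring

open Filter Topology in
lemma tendsto_tsum_hypTermOne_add_natCast (a b c : ℂ) :
    Tendsto (fun m : ℕ => ∑' n, hypTermOne a b (c + m) n) atTop (𝓝 1) := by
  set x : ℝ := ‖a‖ + ‖b‖ + 1 with hxdef
  have hx : 0 < x := by positivity
  have hs : Summable (hypTermOne (‖a‖ : ℂ) (‖b‖ : ℂ) (x : ℂ)) := by
    refine summable_hypTermOne ?_
    simp only [Complex.sub_re, Complex.ofReal_re]
    linarith
  have hev : ∀ᶠ m : ℕ in atTop, x ≤ (c + m).re := by
    simp only [Complex.add_re, Complex.natCast_re]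
    exact (tendsto_atTop_add_const_left _ _ tendsto_natCast_atTop_atTop).eventually_ge_atTop x
  have h := tendsto_tsum_of_dominated_convergence hs.norm
    (tendsto_hypTermOne_add_natCast a b c)
    (hev.mono fun m hm n => norm_hypTermOne_le a b hx hm n)
  rwa [tsum_ite_eq] at h

open Filter Topology in
/-- Gauss summation formula: for `c` not a nonpositive integer and `Re(c−a−b) > 0`,
the series `Σ (a)_n (b)_n / ((c)_n n!)` converges and equals
`Γ(c)Γ(c−a−b)/(Γ(c−a)Γ(c−b))`. -/
theorem gauss_summation (a b c : ℂ) (hc : ∀ n : ℕ, c ≠ -(n : ℂ))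
    (hre : 0 < (c - a - b).re) :
    Summable (hypTermOne a b c) ∧
    ∑' n : ℕ, hypTermOne a b c n =
      Complex.Gamma c * Complex.Gamma (c - a - b) /
        (Complex.Gamma (c - a) * Complex.Gamma (c - b)) := by
  refine ⟨summable_hypTermOne hre, ?_⟩
  have h1 := ((inv_GammaSeq_tendsto c).mul (inv_GammaSeq_tendsto (c - a - b))).mul_const
    (∑' n, hypTermOne a b c n)
  have h2 := ((inv_GammaSeq_tendsto (c - a)).mul (inv_GammaSeq_tendsto (c - b))).mul
    ((tendsto_tsum_hypTermOne_add_natCast a b c).comp (tendsto_add_atTop_nat 1))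
  have heq := tendsto_nhds_unique_of_eventuallyEq h1 h2 <| by
    filter_upwards [eventually_ne_atTop 0] with n hn
    have h := tsum_hypTermOne_contiguous_iterate (n + 1) hc hre
    simp only [ascPochhammer_succ_eval_eq_inv_GammaSeq _ hn] at h
    have hn' : (n : ℂ) ≠ 0 := by exact_mod_cast hn
    have hpow : (n : ℂ) ^ c * (n : ℂ) ^ (c - a - b) = (n : ℂ) ^ (c - a) * (n : ℂ) ^ (c - b) := by
      rw [← Complex.cpow_add _ _ hn', ← Complex.cpow_add _ _ hn']
      ring_nf
    have hne : (n : ℂ) ^ (c - a) * (n : ℂ) ^ (c - b) * (n.factorial : ℂ) ^ 2 ≠ 0 := by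
      simp [Complex.cpow_eq_zero_iff, hn, n.factorial_ne_zero]
    refine mul_left_cancel₀ hne ?_
    simp only [Function.comp_apply]
    rw [← hpow]
    conv_rhs => rw [hpow]
    linear_combination h
  have hΓc := Complex.Gamma_ne_zero hc
  have hΓ := Complex.Gamma_ne_zero_of_re_pos hre
  rw [div_eq_mul_inv, mul_inv, ← mul_one ((Complex.Gamma (c - a))⁻¹ * _), ← heq]
  field_simp
end

section
/- Euler-type integral representation (the (1,1)-entry of the fundamental system Y): let a, b, c ∈ ℝ with a > 0 and c − a > 0, and let z ∈ ℝ with 0 < z < 1. Then the integral ∫_0^z x^{a−1} (1−x)^{−b} (z−x)^{c−a−1} dx (with real powers of the positive quantities x, 1−x, z−x) converges and equals B(a, c−a) · z^{c−1} · F(a,b,c|z), where B(a,b) = Γ(a)Γ(b)/Γ(a+b) is the beta function. -/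
open MeasureTheory

/-- The real Gauss hypergeometric function `F(a,b,c|z)` as the sum of its series. -/
noncomputable def hypFReal (a b c : ℝ) (z : ℝ) : ℝ :=
  ∑' n : ℕ, (ascPochhammer ℝ n).eval a * (ascPochhammer ℝ n).eval b /
    ((ascPochhammer ℝ n).eval c * (n.factorial : ℝ)) * z ^ n

theorem Real.Gamma_add_nat_eq_ascPochhammer_mul {s : ℝ} (hs : 0 < s) (n : ℕ) :
    Real.Gamma (s + n) = (ascPochhammer ℝ n).eval s * Real.Gamma s := by
  induction n with
  | zero => simp
  | succ n ih =>
    rw [Nat.cast_succ, ← add_assoc, Real.Gamma_add_one (by positivity), ih,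
      ascPochhammer_succ_eval]
    ring

/-- The beta integral over `[0, z]` with real exponents. -/
theorem integral_rpow_mul_sub_rpow {u v z : ℝ} (hu : 0 < u) (hv : 0 < v) (hz : 0 < z) :
    ∫ x in (0 : ℝ)..z, x ^ (u - 1) * (z - x) ^ (v - 1) =
      z ^ (u + v - 1) * (Real.Gamma u * Real.Gamma v / Real.Gamma (u + v)) := by
  have h := Complex.betaIntegral_scaled u v hz
  rw [Complex.betaIntegral_eq_Gamma_mul_div _ _ (by simpa) (by simpa)] at h
  apply Complex.ofReal_injective
  rw [← intervalIntegral.integral_ofReal]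
  push_cast [Complex.ofReal_cpow hz.le, ← Complex.Gamma_ofReal]
  rw [← h]
  refine intervalIntegral.integral_congr fun x hx => ?_
  rw [Set.uIcc_of_le hz.le] at hx
  push_cast [Complex.ofReal_cpow hx.1, Complex.ofReal_cpow (sub_nonneg.2 hx.2)]
  rfl

theorem intervalIntegrable_rpow_mul_sub_rpow {u v z : ℝ} (hu : 0 < u) (hv : 0 < v)
    (hz : 0 < z) :
    IntervalIntegrable (fun x : ℝ => x ^ (u - 1) * (z - x) ^ (v - 1)) volume 0 z := by
  apply intervalIntegral.intervalIntegrable_of_integral_ne_zero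
  rw [integral_rpow_mul_sub_rpow hu hv hz]
  have := Real.Gamma_pos_of_pos hu
  have := Real.Gamma_pos_of_pos hv
  have := Real.Gamma_pos_of_pos (add_pos hu hv)
  positivity

/-- The `n`-th moment of the beta weight on `[0, z]`. -/
theorem integral_pow_mul_rpow_mul_sub_rpow {u v z : ℝ} (hu : 0 < u) (hv : 0 < v) (hz : 0 < z)
    (n : ℕ) :
    ∫ x in (0 : ℝ)..z, x ^ n * (x ^ (u - 1) * (z - x) ^ (v - 1)) =
      Real.Gamma u * Real.Gamma v / Real.Gamma (u + v) * z ^ (u + v - 1) *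
        ((ascPochhammer ℝ n).eval u / (ascPochhammer ℝ n).eval (u + v) * z ^ n) := by
  have hn : 0 < u + n := by positivity
  calc
    _ = ∫ x in (0 : ℝ)..z, x ^ (u + n - 1) * (z - x) ^ (v - 1) := by
      refine intervalIntegral.integral_congr_uIoo fun x hx => ?_
      rw [Set.uIoo_of_le hz.le] at hx
      rw [add_sub_right_comm, Real.rpow_add_natCast hx.1.ne']
      ring
    _ = _ := by
      rw [integral_rpow_mul_sub_rpow hn hv hz, Real.Gamma_add_nat_eq_ascPochhammer_mul hu,
        add_right_comm, Real.Gamma_add_nat_eq_ascPochhammer_mul (add_pos hu hv),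
        add_sub_right_comm, Real.rpow_add_natCast hz.ne']
      have := (Real.Gamma_pos_of_pos (add_pos hu hv)).ne'
      have := (ascPochhammer_pos n (u + v) (add_pos hu hv)).ne'
      field_simp

/-- The binomial series of `(1 - x) ^ (-b)`. -/
theorem hasSum_ascPochhammer_mul_pow (b : ℝ) {x : ℝ} (hx : |x| < 1) :
    HasSum (fun n : ℕ => (ascPochhammer ℝ n).eval b / (n.factorial : ℝ) * x ^ n)
      ((1 - x) ^ (-b)) := by
  have hx' : x ∈ Metric.eball (0 : ℝ) 1 := by
    rw [← ENNReal.ofReal_one, Metric.eball_ofReal]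
    simpa using hx
  have h := (Real.one_div_one_sub_rpow_hasFPowerSeriesOnBall_zero b).hasSum hx'
  rw [zero_add, one_div, ← Real.rpow_neg (by linarith [(abs_lt.1 hx).2])] at h
  refine h.congr_fun fun n => ?_
  rw [FormalMultilinearSeries.ofScalars_apply_eq, smul_eq_mul, ← Ring.multichoose_eq,
    div_mul_eq_mul_div, div_eq_iff (by positivity)]
  have := Ring.factorial_nsmul_multichoose_eq_ascPochhammer b n
  rw [Polynomial.ascPochhammer_smeval_eq_eval, nsmul_eq_mul] at this
  rw [← this]
  ring

/-- Euler-type integral representation: for `a > 0`, `c − a > 0` and `0 < z < 1`, the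
integral `∫_0^z x^{a−1}(1−x)^{−b}(z−x)^{c−a−1} dx` converges and equals
`B(a, c−a)·z^{c−1}·F(a,b,c|z)`. -/
theorem euler_integral_representation (a b c z : ℝ) (ha : 0 < a) (hca : 0 < c - a)
    (hz0 : 0 < z) (hz1 : z < 1) :
    IntervalIntegrable
      (fun x : ℝ => x ^ (a - 1) * (1 - x) ^ (-b) * (z - x) ^ (c - a - 1)) volume 0 z ∧
    ∫ x in (0 : ℝ)..z, x ^ (a - 1) * (1 - x) ^ (-b) * (z - x) ^ (c - a - 1) =
      (Real.Gamma a * Real.Gamma (c - a) / Real.Gamma c) * z ^ (c - 1) *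
        hypFReal a b c z := by
  have hac : a + (c - a) = c := by ring
  have hw := intervalIntegrable_rpow_mul_sub_rpow ha hca hz0
  have hrw : (fun x : ℝ => x ^ (a - 1) * (1 - x) ^ (-b) * (z - x) ^ (c - a - 1)) =
      fun x => (1 - x) ^ (-b) * (x ^ (a - 1) * (z - x) ^ (c - a - 1)) := by
    ext x; ring
  rw [hrw]
  constructor
  · refine hw.continuousOn_mul (ContinuousOn.rpow_const (by fun_prop) fun x hx => Or.inl ?_)
    rw [Set.uIcc_of_le hz0.le] at hx
    linarith [hx.2]
  have hzabs : |z| < 1 := by rwa [abs_of_pos hz0]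
  have hsum := intervalIntegral.hasSum_integral_of_dominated_convergence (μ := volume)
    (a := 0) (b := z)
    (F := fun (n : ℕ) x => (ascPochhammer ℝ n).eval b / (n.factorial : ℝ) *
      (x ^ n * (x ^ (a - 1) * (z - x) ^ (c - a - 1))))
    (f := fun x => (1 - x) ^ (-b) * (x ^ (a - 1) * (z - x) ^ (c - a - 1)))
    (fun n x => |(ascPochhammer ℝ n).eval b / (n.factorial : ℝ) * z ^ n| *
      |x ^ (a - 1) * (z - x) ^ (c - a - 1)|)
    (fun n => by fun_prop)
    (fun n => by
      filter_upwards with x hx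
      rw [Set.uIoc_of_le hz0.le] at hx
      rw [Real.norm_eq_abs, ← mul_assoc, abs_mul, abs_mul, abs_mul _ (z ^ n), abs_pow, abs_pow,
        abs_of_pos hx.1, abs_of_pos hz0]
      have := hx.1.le
      have := hx.2
      gcongr)
    (by
      filter_upwards with x _
      exact (hasSum_ascPochhammer_mul_pow b hzabs).summable.abs.mul_right _)
    (by
      simp_rw [tsum_mul_right]
      exact hw.abs.const_mul _)
    (by
      filter_upwards with x hx
      rw [Set.uIoc_of_le hz0.le] at hx
      simp_rw [← mul_assoc _ (_ ^ _) (_ * _)]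
      refine (hasSum_ascPochhammer_mul_pow b ?_).mul_right _
      rw [abs_of_pos hx.1]
      exact hx.2.trans_lt hz1)
  rw [← hsum.tsum_eq, hypFReal, ← tsum_mul_left]
  refine tsum_congr fun n => ?_
  rw [intervalIntegral.integral_const_mul, integral_pow_mul_rpow_mul_sub_rpow ha hca hz0, hac,
    mul_comm ((ascPochhammer ℝ n).eval c), ← div_div]
  ring
end

section
/- The Picard–Fuchs equation (27t³−16t)y'' + (81t²−16)y' + 15t·y = 0 is a pullback of the Gauss hypergeometric equation with parameters a = 5/6, b = 1/6, c = 1 under z = (27/16)t². Precisely: let U ⊆ ℂ be open and let g : U → ℂ be twice complex-differentiable with z(1−z)g''(z) + (1−2z)g'(z) − (5/36)g(z) = 0 for all z ∈ U. Then for every t ∈ ℂ with 27t²/16 ∈ U, the function y(t) := g(27t²/16) satisfies (27t³−16t)y''(t) + (81t²−16)y'(t) + 15t·y(t) = 0. -/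
/-- The Picard–Fuchs equation `(27t³−16t)y'' + (81t²−16)y' + 15t·y = 0` is the pullback of
the Gauss hypergeometric equation with parameters `a = 5/6, b = 1/6, c = 1` under
`z = (27/16)t²`. -/
theorem picard_fuchs_pullback_of_gauss (U : Set ℂ) (hU : IsOpen U) (g : ℂ → ℂ)
    (hg : ∀ z ∈ U, DifferentiableAt ℂ g z)
    (hg' : ∀ z ∈ U, DifferentiableAt ℂ (deriv g) z)
    (heq : ∀ z ∈ U, z * (1 - z) * deriv (deriv g) z
      + (1 - 2 * z) * deriv g z - (5 / 36 : ℂ) * g z = 0) :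
    ∀ t : ℂ, 27 * t ^ 2 / 16 ∈ U →
      (27 * t ^ 3 - 16 * t) * deriv (deriv (fun s : ℂ => g (27 * s ^ 2 / 16))) t
        + (81 * t ^ 2 - 16) * deriv (fun s : ℂ => g (27 * s ^ 2 / 16)) t
        + 15 * t * g (27 * t ^ 2 / 16) = 0 := by
  intro t ht
  have hz (s : ℂ) : HasDerivAt (fun s : ℂ => 27 * s ^ 2 / 16) (27 / 8 * s) s := by
    refine (((hasDerivAt_pow 2 s).const_mul 27).div_const 16).congr_deriv ?_
    push_cast
    ring
  have hy (s : ℂ) (hs : 27 * s ^ 2 / 16 ∈ U) :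
      HasDerivAt (fun s : ℂ => g (27 * s ^ 2 / 16))
        (deriv g (27 * s ^ 2 / 16) * (27 / 8 * s)) s :=
    HasDerivAt.comp s (hg _ hs).hasDerivAt (hz s)
  have hmem : ∀ᶠ s in nhds t, 27 * s ^ 2 / 16 ∈ U :=
    (hz t).continuousAt.eventually (hU.mem_nhds ht)
  have hderiv : deriv (fun s : ℂ => g (27 * s ^ 2 / 16)) =ᶠ[nhds t]
      fun s => deriv g (27 * s ^ 2 / 16) * (27 / 8 * s) :=
    hmem.mono fun s hs => (hy s hs).deriv
  have hy' : HasDerivAt (fun s : ℂ => deriv g (27 * s ^ 2 / 16) * (27 / 8 * s))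
      (deriv (deriv g) (27 * t ^ 2 / 16) * (27 / 8 * t) * (27 / 8 * t)
        + deriv g (27 * t ^ 2 / 16) * (27 / 8 * 1)) t :=
    (HasDerivAt.comp t (hg' _ ht).hasDerivAt (hz t)).mul ((hasDerivAt_id t).const_mul (27 / 8))
  rw [hderiv.deriv_eq, hy'.deriv, (hy t ht).deriv]
  linear_combination (-108 * t) * heq _ ht
end

section
/- Hyperelliptic model of X(6,z): let z ∈ ℂ and let x, y ∈ ℂ with x ≠ 0 satisfy y⁶ = (z−x)(1−z+x)x⁵. Define x₁ := y/x and y₁ := (x² − z² + z)/x. Then y₁² = x₁¹² + (2−4z)x₁⁶ + 1. -/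
/-- Hyperelliptic model of `X(6,z)`: if `y⁶ = (z−x)(1−z+x)x⁵` with `x ≠ 0`, then
`x₁ = y/x`, `y₁ = (x²−z²+z)/x` satisfy `y₁² = x₁¹² + (2−4z)x₁⁶ + 1`. -/
theorem hyperelliptic_model_X6 (z x y : ℂ) (hx : x ≠ 0)
    (h : y ^ 6 = (z - x) * (1 - z + x) * x ^ 5) :
    ((x ^ 2 - z ^ 2 + z) / x) ^ 2 =
      (y / x) ^ 12 + (2 - 4 * z) * (y / x) ^ 6 + 1 := by
  have ht : (y / x) ^ 6 = (z - x) * (1 - z + x) / x := by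
    rw [div_pow, h]
    field_simp
  rw [show (y / x) ^ 12 = ((y / x) ^ 6) ^ 2 by ring, ht]
  field_simp
  ring
end

section
/- The elliptic subfield E₁ of X(6,z): let z ∈ ℂ and let x₁, y₁ ∈ ℂ with x₁ ≠ 0 satisfy y₁² = x₁¹² + (2−4z)x₁⁶ + 1. Define x̃ := (x₁ + x₁⁻¹)² − 2 and ỹ := y₁·x₁⁻³. Then ỹ² = x̃³ − 3x̃ + 2 − 4z. Moreover, if x₁ and y₁ are complex-differentiable functions of a parameter t satisfying this relation identically with x₁ ≠ 0 and y₁ ≠ 0, then (d x̃/dt)/ỹ = 2(x₁⁴ − 1)·(d x₁/dt)/y₁. -/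
/-- The elliptic subfield `E₁` of `X(6,z)`: if `y₁² = x₁¹² + (2−4z)x₁⁶ + 1` with
`x₁ ≠ 0`, then `x̃ = (x₁+x₁⁻¹)² − 2`, `ỹ = y₁x₁⁻³` satisfy `ỹ² = x̃³ − 3x̃ + 2 − 4z`;
moreover for differentiable families one has `dx̃/ỹ = 2(x₁⁴−1)·dx₁/y₁`. -/
theorem elliptic_subfield_E1 (z : ℂ) :
    (∀ x₁ y₁ : ℂ, x₁ ≠ 0 → y₁ ^ 2 = x₁ ^ 12 + (2 - 4 * z) * x₁ ^ 6 + 1 →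
      (y₁ * x₁⁻¹ ^ 3) ^ 2 =
        ((x₁ + x₁⁻¹) ^ 2 - 2) ^ 3 - 3 * ((x₁ + x₁⁻¹) ^ 2 - 2) + 2 - 4 * z) ∧
    (∀ (x₁ y₁ : ℂ → ℂ) (t : ℂ),
      DifferentiableAt ℂ x₁ t → DifferentiableAt ℂ y₁ t →
      (∀ s : ℂ, y₁ s ^ 2 = x₁ s ^ 12 + (2 - 4 * z) * x₁ s ^ 6 + 1) →
      x₁ t ≠ 0 → y₁ t ≠ 0 →
      deriv (fun s => (x₁ s + (x₁ s)⁻¹) ^ 2 - 2) t / (y₁ t * (x₁ t)⁻¹ ^ 3) =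
        2 * (x₁ t ^ 4 - 1) * deriv x₁ t / y₁ t) := by
  refine ⟨fun x y hx h => ?_, fun x y t hx _ _ hx0 hy0 => ?_⟩
  · rw [mul_pow, h]
    field_simp
    ring
  · have hderiv := (((hx.hasDerivAt.add (hx.hasDerivAt.fun_inv hx0)).fun_pow 2).sub_const 2).deriv
    simp only [Pi.add_apply] at hderiv
    rw [hderiv, Nat.cast_ofNat, Nat.add_one_sub_one, pow_one]
    field_simp
    ring
end

section
/- The elliptic subfield E₂ of X(6,z): let z ∈ ℂ, let ζ₆ = e^{2πi/6}, and let x₁, y₁ ∈ ℂ with x₁ ≠ 0 satisfy y₁² = x₁¹² + (2−4z)x₁⁶ + 1. Define x̃ := (x₁ + ζ₆·x₁⁻¹)² − 2ζ₆ and ỹ := y₁·x₁⁻³. Then ỹ² = x̃³ − 3ζ₆²·x̃ + 2 − 4z. -/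
open Complex

/-- With `x̃ = (x + wx⁻¹)² − 2w = x² + w²x⁻²`, one has `x̃³ − 3w²x̃ = x⁶ + w⁶x⁻⁶`. -/
theorem cube_sub_three_mul_sq_mul {K : Type*} [Field K] {x : K} (w : K) (hx : x ≠ 0) :
    ((x + w * x⁻¹) ^ 2 - 2 * w) ^ 3 - 3 * w ^ 2 * ((x + w * x⁻¹) ^ 2 - 2 * w) =
      x ^ 6 + w ^ 6 * x⁻¹ ^ 6 := by
  field_simp
  ring

/-- The elliptic subfield `E₂` of `X(6,z)`: if `y₁² = x₁¹² + (2−4z)x₁⁶ + 1` with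
`x₁ ≠ 0` and `ζ₆ = e^{2πi/6}`, then `x̃ = (x₁+ζ₆x₁⁻¹)² − 2ζ₆`, `ỹ = y₁x₁⁻³` satisfy
`ỹ² = x̃³ − 3ζ₆²x̃ + 2 − 4z`. -/
theorem elliptic_subfield_E2 (z x₁ y₁ : ℂ) (hx : x₁ ≠ 0)
    (h : y₁ ^ 2 = x₁ ^ 12 + (2 - 4 * z) * x₁ ^ 6 + 1) :
    (y₁ * x₁⁻¹ ^ 3) ^ 2 =
      ((x₁ + Complex.exp (2 * Real.pi * Complex.I / 6) * x₁⁻¹) ^ 2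
          - 2 * Complex.exp (2 * Real.pi * Complex.I / 6)) ^ 3
        - 3 * Complex.exp (2 * Real.pi * Complex.I / 6) ^ 2 *
            ((x₁ + Complex.exp (2 * Real.pi * Complex.I / 6) * x₁⁻¹) ^ 2
              - 2 * Complex.exp (2 * Real.pi * Complex.I / 6))
        + 2 - 4 * z := by
  have hζ : Complex.exp (2 * Real.pi * Complex.I / 6) ^ 6 = 1 :=
    (Complex.isPrimitiveRoot_exp 6 (by norm_num)).pow_eq_one
  rw [cube_sub_three_mul_sq_mul _ hx, hζ, mul_pow, h]
  field_simp
  ring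
end

section
/- Let t ∈ ℂ with t ≠ 0, and let x₁, x₂ ∈ ℂ with x₁ + x₂ ≠ 0 satisfy x₁³ + x₂³ − x₁ − x₂ = t. Define x := 3t/(x₁+x₂) + 1 and y := 9t·(x₂/(x₁+x₂) − 1/2). Then (x, y) lies on the elliptic curve E_t, i.e., y² = x³ − 3x + 2 − (27/4)t². (This is the change of coordinates identifying the affine cubic curve {x₁³ + x₂³ − x₁ − x₂ = t} with E_t.) -/
/-- Change of coordinates identifying the affine cubic `{x₁³ + x₂³ − x₁ − x₂ = t}` with
the elliptic curve `E_t : y² = x³ − 3x + 2 − (27/4)t²`: the point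
`(x, y) = (3t/(x₁+x₂) + 1, 9t(x₂/(x₁+x₂) − 1/2))` lies on `E_t`. -/
theorem cubic_curve_to_Et (t x₁ x₂ : ℂ) (ht : t ≠ 0) (hx : x₁ + x₂ ≠ 0)
    (h : x₁ ^ 3 + x₂ ^ 3 - x₁ - x₂ = t) :
    (9 * t * (x₂ / (x₁ + x₂) - 1 / 2)) ^ 2 =
      (3 * t / (x₁ + x₂) + 1) ^ 3 - 3 * (3 * t / (x₁ + x₂) + 1)
        + 2 - 27 / 4 * t ^ 2 := by
  have key : (9 * t * (x₂ / (x₁ + x₂) - 1 / 2)) ^ 2 -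
      ((3 * t / (x₁ + x₂) + 1) ^ 3 - 3 * (3 * t / (x₁ + x₂) + 1) + 2 - 27 / 4 * t ^ 2) =
      27 * t ^ 2 * (x₁ ^ 3 + x₂ ^ 3 - x₁ - x₂ - t) / (x₁ + x₂) ^ 3 := by
    field_simp
    ring
  rw [h, sub_self, mul_zero, zero_div] at key
  exact sub_eq_zero.mp key
end

section
/- Differential form identity on X(6,z) (item 5 of the hyperelliptic-model lemma): let z ∈ ℂ, let U ⊆ ℂ be open, and let x, y : U → ℂ be complex-differentiable functions satisfying y(t)⁶ = (z − x(t))(1 − z + x(t))·x(t)⁵ for all t ∈ U, with x(t) ≠ 0, y(t) ≠ 0. Define x₁ := y/x and y₁ := (x² − z² + z)/x, and suppose y₁(t₀) ≠ 0 at a point t₀ ∈ U. Then x'(t₀)/y(t₀) = −6·x₁(t₀)⁴·x₁'(t₀)/y₁(t₀); i.e., the pullbacks of the differentials dx/y and −6x₁⁴ dx₁/y₁ along the parametrization agree. -/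
/-- Differential form identity on `X(6,z)`: for a differentiable local parametrization
`t ↦ (x(t), y(t))` of `y⁶ = (z−x)(1−z+x)x⁵`, with `x₁ = y/x` and `y₁ = (x²−z²+z)/x`,
the pullbacks of `dx/y` and `−6x₁⁴ dx₁/y₁` agree:
`x'(t₀)/y(t₀) = −6·x₁(t₀)⁴·x₁'(t₀)/y₁(t₀)`. -/
theorem differential_identity_X6 (z : ℂ) (U : Set ℂ) (hU : IsOpen U) (x y : ℂ → ℂ)
    (hx : ∀ t ∈ U, DifferentiableAt ℂ x t) (hy : ∀ t ∈ U, DifferentiableAt ℂ y t)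
    (heq : ∀ t ∈ U, y t ^ 6 = (z - x t) * (1 - z + x t) * x t ^ 5)
    (hx0 : ∀ t ∈ U, x t ≠ 0) (hy0 : ∀ t ∈ U, y t ≠ 0)
    (t₀ : ℂ) (ht₀ : t₀ ∈ U)
    (hy₁ : (x t₀ ^ 2 - z ^ 2 + z) / x t₀ ≠ 0) :
    deriv x t₀ / y t₀ =
      -6 * (y t₀ / x t₀) ^ 4 * deriv (fun t => y t / x t) t₀ /
        ((x t₀ ^ 2 - z ^ 2 + z) / x t₀) := by
  have hX := (hx t₀ ht₀).hasDerivAt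
  have hxt := hx0 t₀ ht₀
  have hyt := hy0 t₀ ht₀
  have hW : HasDerivAt (fun t => y t / x t) (deriv (fun t => y t / x t) t₀) t₀ :=
    ((hy t₀ ht₀).div (hx t₀ ht₀) hxt).hasDerivAt
  have hpow := hW.fun_pow 6
  have hrat := ((hX.const_sub (2 * z - 1)).fun_add ((hX.fun_inv hxt).const_mul (z - z ^ 2)))
  have hev : (fun t => (y t / x t) ^ 6) =ᶠ[nhds t₀]
      fun t => (2 * z - 1 - x t) + (z - z ^ 2) * (x t)⁻¹ := by
    filter_upwards [hU.mem_nhds ht₀] with t ht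
    have hne := hx0 t ht
    rw [div_pow, heq t ht]
    field_simp
    ring
  have key := hpow.unique (hrat.congr_of_eventuallyEq hev)
  generalize deriv (fun t => y t / x t) t₀ = w at key ⊢
  have hnum : x t₀ ^ 2 - z ^ 2 + z ≠ 0 := fun h => hy₁ (by rw [h, zero_div])
  push_cast at key
  field_simp at key ⊢
  linear_combination key
end
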